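/- Let H be a finite connected simple graph of maximum degree at most Δ, and let a, b be two vertices of H such that dist(a,v) + dist(v,b) = dist(a,b) for every vertex v of H. Then H admits an almost majority edge coloring with ⌈√Δ⌉ + 3 colors such that every automorphism φ of H with φ(a) = a and φ(b) = b that preserves the coloring (c(φ(e)) = c(e) for all edges e) is the identity automorphism. -/

import Mathlib

open SimpleGraph

/-- Almost majority edge coloring: the majority condition is required only at vertices of
degree at least 2. -/
def IsAlmostMajorityEdgeColoring {V : Type*} [Fintype V] [DecidableEq V]
    (G : SimpleGraph V) [DecidableRel G.Adj] {k : ℕ} (c : Sym2 V → Fin k) : Prop :=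
  ∀ u : V, ∀ α : Fin k, 2 ≤ G.degree u →
    2 * ((G.neighborFinset u).filter (fun v => c s(u, v) = α)).card ≤ G.degree u

namespace AMC

/-- lexicographic rank of an edge -/
def rk {V : Type*} (N : ℕ) (r : V → ℕ) (x y : V) : ℕ := max (r x) (r y) * N + min (r x) (r y)

lemma rk_comm {V : Type*} (N : ℕ) (r : V → ℕ) (x y : V) : rk N r x y = rk N r y x := by
  simp [rk, max_comm, min_comm]

lemma rk_of_lt {V : Type*} (N : ℕ) (r : V → ℕ) {x y : V} (h : r x < r y) :
    rk N r x y = r y * N + r x := by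
  simp [rk, max_eq_right h.le, min_eq_left h.le]

lemma lex_lt {N a b c d : ℕ} (h : a < c) (hb : b < N) : a * N + b < c * N + d := by
  have : (a + 1) * N ≤ c * N := Nat.mul_le_mul_right _ h
  rw [Nat.add_mul] at this
  omega

lemma rk_inj {V : Type*} {N : ℕ} {r : V → ℕ} (hr : Function.Injective r) (hN : ∀ x, r x < N)
    {x y v u : V} (h : rk N r x y = rk N r v u) : s(x, y) = s(v, u) := by
  unfold rk at h
  have h1 : max (r x) (r y) = max (r v) (r u) := by
    rcases lt_trichotomy (max (r x) (r y)) (max (r v) (r u)) with h' | h' | h'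
    · have := lex_lt (d := min (r v) (r u)) h' (lt_of_le_of_lt (min_le_left (r x) (r y)) (hN x))
      omega
    · exact h'
    · have := lex_lt (d := min (r x) (r y)) h' (lt_of_le_of_lt (min_le_left (r v) (r u)) (hN v))
      omega
  have h2 : min (r x) (r y) = min (r v) (r u) := by rw [h1] at h; omega
  have h3 : (r x = r v ∧ r y = r u) ∨ (r x = r u ∧ r y = r v) := by omega
  rw [Sym2.eq_iff]
  rcases h3 with ⟨h3, h4⟩ | ⟨h3, h4⟩
  · exact Or.inl ⟨hr h3, hr h4⟩
  · exact Or.inr ⟨hr h3, hr h4⟩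

/-- `v` is the parent of `u` -/
def Par {V : Type*} (H : SimpleGraph V) (r : V → ℕ) (b : V) (v u : V) : Prop :=
  H.Adj v u ∧ r v < r u ∧ u ≠ b ∧ ∀ w, H.Adj u w → r v ≤ r w

open Classical in
/-- number of coloured edges of type `Q` at `x` with colour `α` at time `t` -/
noncomputable def num {V : Type*} [Fintype V] {k : ℕ} (Q : V → V → Prop) (ρ : V → V → ℕ)
    (c : Sym2 V → Fin k) (t : ℕ) (x : V) (α : Fin k) : ℕ :=
  (Finset.univ.filter fun y => Q x y ∧ ρ x y < t ∧ c s(x, y) = α).card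

/-- all edges at `x` are coloured at time `t` -/
def fin {V : Type*} (H : SimpleGraph V) (ρ : V → V → ℕ) (t : ℕ) (x : V) : Prop :=
  ∀ y, H.Adj x y → ρ x y < t

open Classical in
lemma sum_num {V : Type*} [Fintype V] {k : ℕ} (Q : V → V → Prop) (ρ : V → V → ℕ)
    (c : Sym2 V → Fin k) (t : ℕ) (x : V) :
    ∑ α, num Q ρ c t x α = (Finset.univ.filter fun y => Q x y ∧ ρ x y < t).card := by
  rw [Finset.card_eq_sum_card_fiberwise (f := fun y => c s(x, y)) (t := Finset.univ)
    (by intro y _; simp)]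
  refine Finset.sum_congr rfl fun α _ => ?_
  unfold num
  rw [Finset.filter_filter]
  simp only [and_assoc]

open Classical in
lemma num_step {V : Type*} [Fintype V] {k : ℕ} (Q : V → V → Prop) {N : ℕ} {r : V → ℕ}
    (hr : Function.Injective r) (hN : ∀ x, r x < N) (c : Sym2 V → Fin k) (v u : V)
    (hvu : v ≠ u) (α : Fin k) (x : V) (β : Fin k) :
    num Q (rk N r) (Function.update c s(v, u) α) (rk N r v u + 1) x β =
      num Q (rk N r) c (rk N r v u) x β +
        if ((x = v ∧ Q v u) ∨ (x = u ∧ Q u v)) ∧ β = α then 1 else 0 := by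
  have key : ∀ y, (rk N r x y < rk N r v u + 1 ∧ Function.update c s(v, u) α s(x, y) = β) ↔
      (rk N r x y < rk N r v u ∧ c s(x, y) = β) ∨ (s(x, y) = s(v, u) ∧ α = β) := by
    intro y
    by_cases h : s(x, y) = s(v, u)
    · have : rk N r x y = rk N r v u := by
        rcases Sym2.eq_iff.1 h with ⟨rfl, rfl⟩ | ⟨rfl, rfl⟩
        · rfl
        · exact rk_comm _ _ _ _
      rw [h, this]; simp
    · rw [Function.update_of_ne h]
      have : rk N r x y ≠ rk N r v u := fun h' => h (rk_inj hr hN h')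
      simp only [h, false_and, or_false]
      constructor
      · rintro ⟨h1, h2⟩; exact ⟨by omega, h2⟩
      · rintro ⟨h1, h2⟩; exact ⟨by omega, h2⟩
  unfold num
  simp only [key]
  have hsplit : (Finset.univ.filter fun y => Q x y ∧
      ((rk N r x y < rk N r v u ∧ c s(x, y) = β) ∨ (s(x, y) = s(v, u) ∧ α = β))) =
      (Finset.univ.filter fun y => Q x y ∧ rk N r x y < rk N r v u ∧ c s(x, y) = β) ∪
      (Finset.univ.filter fun y => Q x y ∧ s(x, y) = s(v, u) ∧ α = β) := by
    ext y; simp only [Finset.mem_filter, Finset.mem_union, Finset.mem_univ, true_and]; tauto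
  rw [hsplit, Finset.card_union_of_disjoint]
  · congr 1
    split_ifs with h
    · obtain ⟨h, rfl⟩ := h
      rw [Finset.card_eq_one]
      rcases h with ⟨rfl, h⟩ | ⟨rfl, h⟩
      · refine ⟨u, ?_⟩
        ext y
        simp only [Finset.mem_filter, Finset.mem_univ, true_and, Finset.mem_singleton, and_true,
          Sym2.eq_iff]
        constructor
        · rintro ⟨_, h | h⟩
          · exact h
          · exact absurd h.1 hvu
        · rintro rfl; exact ⟨h, Or.inl rfl⟩
      · refine ⟨v, ?_⟩
        ext y
        simp only [Finset.mem_filter, Finset.mem_univ, true_and, Finset.mem_singleton, and_true,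
          Sym2.eq_iff]
        constructor
        · rintro ⟨_, h | h⟩
          · exact absurd h.1.symm hvu
          · exact h
        · rintro rfl; exact ⟨h, Or.inr rfl⟩
    · rw [Finset.card_eq_zero, Finset.filter_eq_empty_iff]
      rintro y _ ⟨h1, h2, h3⟩
      apply h
      refine ⟨?_, h3.symm⟩
      rcases Sym2.eq_iff.1 h2 with ⟨rfl, rfl⟩ | ⟨rfl, rfl⟩
      · exact Or.inl ⟨rfl, h1⟩
      · exact Or.inr ⟨rfl, h1⟩
  · rw [Finset.disjoint_filter]
    rintro y _ ⟨_, h1, _⟩ ⟨_, h2, _⟩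
    rcases Sym2.eq_iff.1 h2 with ⟨rfl, rfl⟩ | ⟨rfl, rfl⟩
    · omega
    · rw [rk_comm] at h1; omega

/-- invariant of the greedy colouring -/
structure Inv {V : Type*} [Fintype V] (H : SimpleGraph V) [DecidableRel H.Adj] (r : V → ℕ)
    (b : V) (ρ : V → V → ℕ) (q t : ℕ) (c : Sym2 V → Fin (q + 3)) : Prop where
  maj : ∀ x α, 2 ≤ H.degree x → 2 * num H.Adj ρ c t x α ≤ H.degree x
  load : ∀ x α, num (Par H r b) ρ c t x α + 1 ≤ q
  bal : ∀ x, ¬ fin H ρ t x → (∃ α, q ≤ num (Par H r b) ρ c t x α + 1) →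
    q + 2 ≤ (Finset.univ.filter fun β => q ≤ num (Par H r b) ρ c t x β + 2).card
  pal : ∀ z x y, Par H r b z x → Par H r b z y → x ≠ y → fin H ρ t x → fin H ρ t y →
    c s(z, x) = c s(z, y) → ∃ α, num H.Adj ρ c t x α ≠ num H.Adj ρ c t y α

/-- blocked colours at `x` -/
noncomputable def blk {V : Type*} [Fintype V] (H : SimpleGraph V) [DecidableRel H.Adj]
    (ρ : V → V → ℕ) {k : ℕ} (c : Sym2 V → Fin k) (t : ℕ) (x : V) : Finset (Fin k) :=
  Finset.univ.filter fun α => 2 ≤ H.degree x ∧ H.degree x < 2 * (num H.Adj ρ c t x α + 1)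

section
variable {V : Type*} [Fintype V] (H : SimpleGraph V) [DecidableRel H.Adj] (ρ : V → V → ℕ)
  {k : ℕ} (c : Sym2 V → Fin k) (t : ℕ) (x : V)

lemma blk_mul : (blk H ρ c t x).card * (H.degree x - 1) ≤
    2 * ∑ α ∈ blk H ρ c t x, num H.Adj ρ c t x α := by
  rw [Finset.mul_sum, ← smul_eq_mul]
  apply Finset.card_nsmul_le_sum
  intro α hα
  simp only [blk, Finset.mem_filter] at hα
  omega

open Classical in
lemma done_le (T : Finset V) (hT : ∀ y ∈ T, H.Adj x y ∧ ¬ ρ x y < t) :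
    ∑ α, num H.Adj ρ c t x α + T.card ≤ H.degree x := by
  rw [sum_num, ← Finset.card_union_of_disjoint, ← SimpleGraph.card_neighborFinset_eq_degree]
  · apply Finset.card_le_card
    intro y hy
    rw [SimpleGraph.mem_neighborFinset]
    rcases Finset.mem_union.1 hy with hy | hy
    · simp only [Finset.mem_filter] at hy
      exact hy.2.1
    · exact (hT y hy).1
  · rw [Finset.disjoint_left]
    intro y hy hy'
    simp only [Finset.mem_filter] at hy
    exact (hT y hy').2 hy.2.2

lemma blk_deg (h : (blk H ρ c t x).Nonempty) : 2 ≤ H.degree x := by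
  obtain ⟨α, hα⟩ := h
  simp only [blk, Finset.mem_filter] at hα
  exact hα.2.1

lemma blk_le_of (m : ℕ) (hm : 2 ≤ H.degree x →
    2 * ∑ α, num H.Adj ρ c t x α < (m + 1) * (H.degree x - 1)) :
    (blk H ρ c t x).card ≤ m := by
  by_contra! hlt
  have hd := blk_deg H ρ c t x (Finset.card_pos.1 (by omega))
  have h1 := blk_mul H ρ c t x
  have h2 : ∑ α ∈ blk H ρ c t x, num H.Adj ρ c t x α ≤ ∑ α, num H.Adj ρ c t x α :=
    Finset.sum_le_sum_of_subset (Finset.subset_univ _)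
  have h3 : (m + 1) * (H.degree x - 1) ≤ (blk H ρ c t x).card * (H.degree x - 1) :=
    Nat.mul_le_mul_right _ hlt
  have := hm hd
  omega

lemma blk_le_two {y : V} (hy : H.Adj x y) (hyt : ¬ ρ x y < t) : (blk H ρ c t x).card ≤ 2 := by
  apply blk_le_of
  intro hd
  have := done_le H ρ c t x {y} (by simpa using ⟨hy, by omega⟩)
  simp at this
  omega

open Classical in
lemma blk_le_one {y z : V} (hyz : y ≠ z) (hy : H.Adj x y) (hyt : ¬ ρ x y < t) (hz : H.Adj x z)
    (hzt : ¬ ρ x z < t) : (blk H ρ c t x).card ≤ 1 := by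
  apply blk_le_of
  intro hd
  have := done_le H ρ c t x {y, z} (by
    intro w hw
    rcases Finset.mem_insert.1 hw with rfl | hw
    · exact ⟨hy, hyt⟩
    · rw [Finset.mem_singleton.1 hw]; exact ⟨hz, hzt⟩)
  rw [Finset.card_pair hyz] at this
  omega

lemma blk_zero (h : ∀ α, num H.Adj ρ c t x α = 0) : (blk H ρ c t x) = ∅ := by
  rw [← Finset.card_eq_zero, ← Nat.le_zero]
  apply blk_le_of
  intro hd
  simp [h]; omega

lemma num_zero_of_two {y : V} (hy : H.Adj x y) (hyt : ¬ ρ x y < t)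
    (h2 : (blk H ρ c t x).card = 2) {β : Fin k} (hβ : β ∉ blk H ρ c t x) :
    num H.Adj ρ c t x β = 0 := by
  have hd := blk_deg H ρ c t x (Finset.card_pos.1 (by omega))
  have h1 := blk_mul H ρ c t x
  have h3 := done_le H ρ c t x {y} (by simpa using ⟨hy, by omega⟩)
  have h4 : ∑ α ∈ insert β (blk H ρ c t x), num H.Adj ρ c t x α ≤ ∑ α, num H.Adj ρ c t x α :=
    Finset.sum_le_sum_of_subset (Finset.subset_univ _)
  rw [Finset.sum_insert hβ] at h4
  rw [h2] at h1
  simp at h3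
  omega

end

open Classical in
lemma num_eq_zero {V : Type*} [Fintype V] {k : ℕ} (Q : V → V → Prop) (ρ : V → V → ℕ)
    (c : Sym2 V → Fin k) (t : ℕ) (x : V) (α : Fin k) (h : ∀ y, Q x y → ¬ ρ x y < t) :
    num Q ρ c t x α = 0 := by
  unfold num
  rw [Finset.card_eq_zero, Finset.filter_eq_empty_iff]
  rintro y _ ⟨h1, h2, -⟩
  exact h y h1 h2

open Classical in
/-- colours which would complete the palette of `v` to that of a finished mate -/
noncomputable def exc {V : Type*} [Fintype V] (H : SimpleGraph V) (r : V → ℕ) (b : V)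
    (ρ : V → V → ℕ) {k : ℕ} (c : Sym2 V → Fin k) (t : ℕ) (v : V) : Finset (Fin k) :=
  Finset.univ.filter fun α => ∃ z y, Par H r b z v ∧ Par H r b z y ∧ y ≠ v ∧ fin H ρ t y ∧
    c s(z, v) = c s(z, y) ∧
    ∀ β, num H.Adj ρ c t v β + (if β = α then 1 else 0) = num H.Adj ρ c t y β

lemma Par.unique {V : Type*} {H : SimpleGraph V} {r : V → ℕ} (hr : Function.Injective r) {b : V}
    {z z' v : V} (h : Par H r b z v) (h' : Par H r b z' v) : z = z' :=
  hr (le_antisymm (h.2.2.2 _ h'.1.symm) (h'.2.2.2 _ h.1.symm))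

open Classical in
lemma exc_card {V : Type*} [Fintype V] (H : SimpleGraph V) {r : V → ℕ}
    (hr : Function.Injective r) (b : V)
    (ρ : V → V → ℕ) (hρ : ∀ x y, ρ x y = ρ y x) {k : ℕ} (c : Sym2 V → Fin k) (t : ℕ) (v : V)
    (q : ℕ) (hq : 2 ≤ q)
    (hload : ∀ x α, num (Par H r b) ρ c t x α + 1 ≤ q) (hv : ∀ z, Par H r b z v → ρ z v < t) :
    (exc H r b ρ c t v).card + 2 ≤ q := by
  by_cases hne : (exc H r b ρ c t v).Nonempty
  · obtain ⟨α₀, hα₀⟩ := hne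
    simp only [exc, Finset.mem_filter, Finset.mem_univ, true_and] at hα₀
    obtain ⟨z, -, hz, -⟩ := hα₀
    set M := (Finset.univ.filter fun y => Par H r b z y ∧ ρ z y < t ∧ c s(z, y) = c s(z, v)) with hM
    have hvM : v ∈ M := by simp [hM, hz, hv z hz]
    have hMc : M.card + 1 ≤ q := hload z (c s(z, v))
    have h1 : (M.erase v).card + 1 = M.card := Finset.card_erase_add_one hvM
    have h2 : (exc H r b ρ c t v).card ≤ (M.erase v).card := by
      apply Finset.card_le_card_of_forall_subsingleton
        (fun α y => ∀ β, num H.Adj ρ c t v β + (if β = α then 1 else 0) = num H.Adj ρ c t y β)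
      · intro α hα
        simp only [exc, Finset.mem_filter, Finset.mem_univ, true_and] at hα
        obtain ⟨z', y, hz', hy, hyv, hf, hc, hn⟩ := hα
        obtain rfl := hz'.unique hr hz
        refine ⟨y, ?_, hn⟩
        simp only [hM, Finset.mem_erase, Finset.mem_filter, Finset.mem_univ, true_and]
        refine ⟨hyv, hy, ?_, hc.symm⟩
        rw [hρ]
        exact hf _ hy.1.symm
      · rintro y - α ⟨-, hα⟩ α' ⟨-, hα'⟩
        by_contra hne
        have e1 := hα α
        have e2 := hα' α
        rw [if_pos rfl] at e1
        rw [if_neg hne] at e2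
        omega
    omega
  · rw [Finset.not_nonempty_iff_eq_empty.1 hne]; simpa using hq

lemma par_le_adj {V : Type*} [Fintype V] (H : SimpleGraph V) (r : V → ℕ) (b : V)
    (ρ : V → V → ℕ) {k : ℕ} (c : Sym2 V → Fin k) (t : ℕ) (v : V) (α : Fin k) :
    num (Par H r b) ρ c t v α ≤ num H.Adj ρ c t v α := by
  unfold num
  apply Finset.card_le_card
  intro y hy
  simp only [Finset.mem_filter, Finset.mem_univ, true_and] at hy ⊢
  exact ⟨hy.1.1, hy.2⟩

open Classical in
lemma choose_color {V : Type*} [Fintype V] (H : SimpleGraph V) [DecidableRel H.Adj] {r : V → ℕ}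
    (hr : Function.Injective r) (b : V) {N : ℕ} (hN : ∀ x, r x < N) (q : ℕ) (hq : 2 ≤ q)
    (hdeg : ∀ x, H.degree x ≤ q * q) (hb : ∀ u, u ≠ b → ∃ w, H.Adj u w ∧ r u < r w)
    (c : Sym2 V → Fin (q + 3)) (v u : V) (hvu : H.Adj v u) (hlt : r v < r u)
    (hI : Inv H r b (rk N r) q (rk N r v u) c) :
    ∃ α, α ∉ blk H (rk N r) c (rk N r v u) v ∧ α ∉ blk H (rk N r) c (rk N r v u) u ∧
      (fin H (rk N r) (rk N r v u + 1) v → α ∉ exc H r b (rk N r) c (rk N r v u) v) ∧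
      (Par H r b v u → num (Par H r b) (rk N r) c (rk N r v u) v α + 2 ≤ q ∧
        (¬ fin H (rk N r) (rk N r v u + 1) v →
          q ≤ num (Par H r b) (rk N r) c (rk N r v u) v α + 2 →
          q + 2 ≤ (Finset.univ.filter fun β =>
            q ≤ num (Par H r b) (rk N r) c (rk N r v u) v β + 2).card)) := by
  set t := rk N r v u with ht
  set ρ := rk N r with hρ
  set Bv := blk H ρ c t v with hBv
  set Bu := blk H ρ c t u with hBu
  set L := fun α => num (Par H r b) ρ c t v α with hL
  set E := if fin H ρ (t + 1) v then exc H r b ρ c t v else ∅ with hE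
  set A := Finset.univ \ (Bv ∪ Bu ∪ E) with hA
  have hρc : ∀ x y, ρ x y = ρ y x := rk_comm N r
  have hρlt : ∀ x y, r x < r y → ρ x y = r y * N + r x := fun x y h => rk_of_lt N r h
  have htv : ¬ ρ v u < t := lt_irrefl _
  have htu : ¬ ρ u v < t := by rw [hρc]; exact lt_irrefl _
  have hEc : E.card + 2 ≤ q := by
    rw [hE]
    split_ifs
    · refine exc_card H hr b ρ hρc c t v q hq hI.load ?_
      intro z hz
      rw [ht, hρlt _ _ hz.2.1, hρlt _ _ hlt]
      exact lex_lt hlt (hN z)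
    · simpa using hq
  have hBv2 : Bv.card ≤ 2 := blk_le_two H ρ c t v hvu htv
  have hBu2 : Bu.card ≤ 2 := blk_le_two H ρ c t u hvu.symm htu
  have hAc : q + 3 ≤ A.card + (Bv.card + Bu.card + E.card) := by
    have h1 : (Bv ∪ Bu ∪ E).card ≤ Bv.card + Bu.card + E.card :=
      (Finset.card_union_le _ _).trans (Nat.add_le_add_right (Finset.card_union_le _ _) _)
    have h2 : A.card + (Bv ∪ Bu ∪ E).card = q + 3 := by
      rw [hA, Finset.card_sdiff_add_card_eq_card (Finset.subset_univ _)]; simp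
    omega
  have hAne : A.Nonempty := Finset.card_pos.1 (by omega)
  obtain ⟨α, hαA, hmin⟩ := Finset.exists_min_image A L hAne
  have hmem : ∀ β ∈ A, β ∉ Bv ∧ β ∉ Bu ∧ β ∉ E := by
    intro β hβ
    simp only [hA, Finset.mem_sdiff, Finset.mem_union, Finset.mem_univ, true_and] at hβ
    tauto
  refine ⟨α, (hmem α hαA).1, (hmem α hαA).2.1, ?_, ?_⟩
  · intro hf
    have := (hmem α hαA).2.2
    rwa [hE, if_pos hf] at this
  intro hP
  have hBu0 : Bu = ∅ := by
    apply blk_zero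
    intro β
    apply num_eq_zero
    intro y h1 h2
    have h3 := hP.2.2.2 y h1
    have h4 : r y < r u ∨ r u < r y := by
      rcases lt_trichotomy (r y) (r u) with h | h | h
      · exact Or.inl h
      · exact absurd (hr h) h1.symm.ne
      · exact Or.inr h
    rw [ht, hρlt _ _ hlt] at h2
    rcases h4 with h4 | h4
    · rw [hρc, hρlt _ _ h4] at h2; omega
    · rw [hρlt _ _ h4] at h2
      have := lex_lt (d := r u) h4 (hN v)
      omega
  have hBu0' : Bu.card = 0 := by rw [hBu0]; rfl
  have hsum : ∑ β, L β + 1 ≤ q * q := by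
    have h1 : ∑ β, L β ≤ ∑ β, num H.Adj ρ c t v β :=
      Finset.sum_le_sum fun β _ => par_le_adj H r b ρ c t v β
    have h2 := done_le H ρ c t v {u} (by simpa using ⟨hvu, le_of_eq rfl⟩)
    have := hdeg v
    simp only [Finset.card_singleton] at h2
    omega
  by_cases hf : fin H ρ (t + 1) v
  · refine ⟨?_, fun h => absurd hf h⟩
    change L α + 2 ≤ q
    rcases (by omega : Bv.card ≤ 1 ∨ Bv.card = 2) with h1 | h2
    · by_contra! hc
      have hnf : ¬ fin H ρ t v := fun h => htv (h u hvu)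
      have hbal := hI.bal v hnf ⟨α, by change q ≤ L α + 1; omega⟩
      set F := (Finset.univ.filter fun β => q ≤ num (Par H r b) ρ c t v β + 2) with hF
      have hA4 : 4 ≤ A.card := by omega
      have hAF : A ⊆ F := by
        intro β hβ
        have := hmin β hβ
        simp only [hF, Finset.mem_filter, Finset.mem_univ, true_and]
        change q ≤ L β + 2
        omega
      have e1 : F.card * (q - 2) + A.card ≤ ∑ β, L β := by
        have e2 : ∑ β ∈ F, ((q - 2) + if β ∈ A then 1 else 0) ≤ ∑ β ∈ F, L β := by
          apply Finset.sum_le_sum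
          intro β hβ
          split_ifs with hβA
          · have := hmin β hβA; omega
          · simp only [hF, Finset.mem_filter, Finset.mem_univ, true_and] at hβ
            change q ≤ L β + 2 at hβ
            omega
        rw [Finset.sum_add_distrib, Finset.sum_const, smul_eq_mul, Finset.sum_ite_mem,
          Finset.inter_eq_right.2 hAF, Finset.sum_const, smul_eq_mul, mul_one] at e2
        exact e2.trans (Finset.sum_le_sum_of_subset (Finset.subset_univ _))
      have e3 : (q + 2) * (q - 2) ≤ F.card * (q - 2) := Nat.mul_le_mul_right _ hbal
      obtain ⟨p, rfl⟩ := Nat.exists_eq_add_of_le hq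
      simp only [Nat.add_sub_cancel_left] at e1 e3
      nlinarith
    · have h0 := num_zero_of_two H ρ c t v hvu htv h2 (hmem α hαA).1
      have h3 := par_le_adj H r b ρ c t v α
      change L α ≤ _ at h3
      omega
  · have hBv1 : Bv.card ≤ 1 := by
      simp only [fin, not_forall] at hf
      obtain ⟨y, hy, hyt⟩ := hf
      refine blk_le_one H ρ c t v (y := y) (z := u) ?_ hy (by omega) hvu htv
      rintro rfl
      exact hyt (by rw [ht]; exact Nat.lt_succ_self _)
    have hE0 : E.card = 0 := by rw [hE, if_neg hf]; rfl
    have hA2 : q + 2 ≤ A.card := by omega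
    refine ⟨?_, ?_⟩
    · change L α + 2 ≤ q
      by_contra! hc
      have e1 : A.card * (q - 1) ≤ ∑ β ∈ A, L β := by
        rw [← smul_eq_mul]
        apply Finset.card_nsmul_le_sum
        intro β hβ
        have := hmin β hβ
        omega
      have e2 : ∑ β ∈ A, L β ≤ ∑ β, L β := Finset.sum_le_sum_of_subset (Finset.subset_univ _)
      have e3 : (q + 2) * (q - 1) ≤ A.card * (q - 1) := Nat.mul_le_mul_right _ hA2
      obtain ⟨p, rfl⟩ := Nat.exists_eq_add_of_le hq
      have : 2 + p - 1 = p + 1 := by omega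
      rw [this] at e1 e3
      nlinarith
    · intro _ hα
      refine hA2.trans (Finset.card_le_card ?_)
      intro β hβ
      have := hmin β hβ
      simp only [Finset.mem_filter, Finset.mem_univ, true_and]
      change q ≤ L α + 2 at hα
      change q ≤ L β + 2
      omega

open Classical in
lemma step_edge {V : Type*} [Fintype V] (H : SimpleGraph V) [DecidableRel H.Adj] {r : V → ℕ}
    (hr : Function.Injective r) (b : V) {N : ℕ} (hN : ∀ x, r x < N) (q : ℕ) (hq : 2 ≤ q)
    (hdeg : ∀ x, H.degree x ≤ q * q) (hb : ∀ u, u ≠ b → ∃ w, H.Adj u w ∧ r u < r w)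
    (c : Sym2 V → Fin (q + 3)) (v u : V) (hvu : H.Adj v u) (hlt : r v < r u)
    (hI : Inv H r b (rk N r) q (rk N r v u) c) :
    ∃ c', Inv H r b (rk N r) q (rk N r v u + 1) c' := by
  obtain ⟨α, hαv, hαu, hαE, hαP⟩ := choose_color H hr b hN q hq hdeg hb c v u hvu hlt hI
  refine ⟨Function.update c s(v, u) α, ?_⟩
  have hne : v ≠ u := hvu.ne
  have hnP : ¬ Par H r b u v := fun h => by have := h.2.1; omega
  have hadj := num_step H.Adj hr hN c v u hne α
  have hpar := num_step (Par H r b) hr hN c v u hne α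
  simp only [hvu, hvu.symm, and_true] at hadj
  simp only [hnP, and_false, or_false] at hpar
  have hnfv : ¬ fin H (rk N r) (rk N r v u) v := fun h => lt_irrefl _ (h u hvu)
  have hnfu : ¬ fin H (rk N r) (rk N r v u) u := fun h => by
    have := h v hvu.symm
    rw [rk_comm] at this
    exact lt_irrefl _ this
  have hnfu' : u ≠ b → ¬ fin H (rk N r) (rk N r v u + 1) u := fun hub h => by
    obtain ⟨w, hw, hw'⟩ := hb u hub
    have h1 := h w hw
    rw [rk_of_lt _ _ hw', rk_of_lt _ _ hlt] at h1
    have := lex_lt (d := r u) hw' (hN v)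
    omega
  have hfin : ∀ x, x ≠ b → fin H (rk N r) (rk N r v u + 1) x →
      ¬ fin H (rk N r) (rk N r v u) x → x = v := by
    intro x hxb h1 h2
    simp only [fin, not_forall] at h2
    obtain ⟨y, hy, hyt⟩ := h2
    have h3 := h1 y hy
    have h4 : rk N r x y = rk N r v u := by omega
    rcases Sym2.eq_iff.1 (rk_inj hr hN h4) with ⟨rfl, rfl⟩ | ⟨rfl, rfl⟩
    · rfl
    · exact absurd h1 (hnfu' hxb)
  have hmono : ∀ x, fin H (rk N r) (rk N r v u) x → fin H (rk N r) (rk N r v u + 1) x :=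
    fun x h y hy => Nat.lt_succ_of_lt (h y hy)
  -- the main case of the palette condition
  have hpal : ∀ z y, Par H r b z v → Par H r b z y → v ≠ y →
      fin H (rk N r) (rk N r v u + 1) v → fin H (rk N r) (rk N r v u + 1) y →
      Function.update c s(v, u) α s(z, v) = Function.update c s(v, u) α s(z, y) →
      ∃ β, num H.Adj (rk N r) (Function.update c s(v, u) α) (rk N r v u + 1) v β ≠
        num H.Adj (rk N r) (Function.update c s(v, u) α) (rk N r v u + 1) y β := by
    intro z y hzv hzy hvy hfv hfy hc
    have hyf : fin H (rk N r) (rk N r v u) y := by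
      by_contra h
      exact hvy (hfin y hzy.2.2.1 hfy h).symm
    have hyu : y ≠ u := by rintro rfl; exact hnfu hyf
    have hzv' := hzv.2.1
    have hzu : z ≠ u := by rintro rfl; omega
    have hzv'' : z ≠ v := hzv.1.ne
    rw [Function.update_of_ne, Function.update_of_ne] at hc
    · by_contra! hall
      apply hαE hfv
      simp only [exc, Finset.mem_filter, Finset.mem_univ, true_and]
      refine ⟨z, y, hzv, hzy, hvy.symm, hyf, hc, ?_⟩
      intro β
      have := hall β
      rw [hadj, hadj] at this
      simpa [hvy.symm, hyu] using this
    · intro h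
      rcases Sym2.eq_iff.1 h with ⟨h, _⟩ | ⟨h, _⟩
      · exact hzv'' h
      · exact hzu h
    · intro h
      rcases Sym2.eq_iff.1 h with ⟨h, _⟩ | ⟨h, _⟩
      · exact hzv'' h
      · exact hzu h
  refine ⟨?_, ?_, ?_, ?_⟩
  · intro x β hx
    have h0 := hI.maj x β hx
    rw [hadj]
    split_ifs with h
    · obtain ⟨hx', rfl⟩ := h
      rcases hx' with rfl | rfl
      · simp only [blk, Finset.mem_filter, Finset.mem_univ, true_and, not_and, not_lt] at hαv
        exact hαv hx
      · simp only [blk, Finset.mem_filter, Finset.mem_univ, true_and, not_and, not_lt] at hαu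
        exact hαu hx
    · exact h0
  · intro x β
    have h0 := hI.load x β
    rw [hpar]
    split_ifs with h
    · obtain ⟨⟨rfl, hP⟩, rfl⟩ := h
      have := (hαP hP).1
      omega
    · exact h0
  · intro x hx hex
    have hx0 : ¬ fin H (rk N r) (rk N r v u) x := fun h => hx (hmono x h)
    have hsub : (Finset.univ.filter fun β => q ≤ num (Par H r b) (rk N r) c (rk N r v u) x β + 2) ⊆
        (Finset.univ.filter fun β => q ≤ num (Par H r b) (rk N r) (Function.update c s(v, u) α)
          (rk N r v u + 1) x β + 2) := by
      intro β hβ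
      simp only [Finset.mem_filter, Finset.mem_univ, true_and] at hβ ⊢
      rw [hpar]
      omega
    refine le_trans ?_ (Finset.card_le_card hsub)
    obtain ⟨β, hβ⟩ := hex
    rw [hpar] at hβ
    split_ifs at hβ with h
    · obtain ⟨⟨rfl, hP⟩, rfl⟩ := h
      exact (hαP hP).2 hx (by omega)
    · exact hI.bal x hx0 ⟨β, by omega⟩
  · intro z x y hzx hzy hxy hfx hfy hc
    by_cases hxv : x = v
    · subst hxv
      exact hpal z y hzx hzy hxy hfx hfy hc
    by_cases hyv : y = v
    · subst hyv
      obtain ⟨β, hβ⟩ := hpal z x hzy hzx hxy.symm hfy hfx hc.symm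
      exact ⟨β, hβ.symm⟩
    have hfx0 : fin H (rk N r) (rk N r v u) x := by
      by_contra h; exact hxv (hfin x hzx.2.2.1 hfx h)
    have hfy0 : fin H (rk N r) (rk N r v u) y := by
      by_contra h; exact hyv (hfin y hzy.2.2.1 hfy h)
    have hxu : x ≠ u := by rintro rfl; exact hnfu hfx0
    have hyu : y ≠ u := by rintro rfl; exact hnfu hfy0
    rw [Function.update_of_ne, Function.update_of_ne] at hc
    · obtain ⟨β, hβ⟩ := hI.pal z x y hzx hzy hxy hfx0 hfy0 hc
      refine ⟨β, ?_⟩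
      rw [hadj, hadj]
      simpa [hxv, hyv, hxu, hyu] using hβ
    · intro h
      rcases Sym2.eq_iff.1 h with ⟨_, h⟩ | ⟨_, h⟩
      · exact hyu h
      · exact hyv h
    · intro h
      rcases Sym2.eq_iff.1 h with ⟨_, h⟩ | ⟨_, h⟩
      · exact hxu h
      · exact hxv h

open Classical in
lemma num_congr_time {V : Type*} [Fintype V] {k : ℕ} (Q : V → V → Prop) (ρ : V → V → ℕ)
    (c : Sym2 V → Fin k) (t : ℕ) (x : V) (α : Fin k) (h : ∀ y, Q x y → ρ x y ≠ t) :
    num Q ρ c (t + 1) x α = num Q ρ c t x α := by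
  unfold num
  congr 1
  apply Finset.filter_congr
  intro y _
  constructor
  · rintro ⟨h1, h2, h3⟩
    have := h y h1
    exact ⟨h1, by omega, h3⟩
  · rintro ⟨h1, h2, h3⟩
    exact ⟨h1, by omega, h3⟩

lemma exists_inv {V : Type*} [Fintype V] (H : SimpleGraph V) [DecidableRel H.Adj] {r : V → ℕ}
    (hr : Function.Injective r) (b : V) {N : ℕ} (hN : ∀ x, r x < N) (q : ℕ) (hq : 2 ≤ q)
    (hdeg : ∀ x, H.degree x ≤ q * q) (hb : ∀ u, u ≠ b → ∃ w, H.Adj u w ∧ r u < r w) (t : ℕ) :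
    ∃ c, Inv H r b (rk N r) q t c := by
  induction t with
  | zero =>
    refine ⟨fun _ => 0, ?_, ?_, ?_, ?_⟩
    · intro x α _
      rw [num_eq_zero _ _ _ _ _ _ (fun _ _ => Nat.not_lt_zero _)]; omega
    · intro x α
      rw [num_eq_zero _ _ _ _ _ _ (fun _ _ => Nat.not_lt_zero _)]; omega
    · rintro x - ⟨α, hα⟩
      rw [num_eq_zero _ _ _ _ _ _ (fun _ _ => Nat.not_lt_zero _)] at hα; omega
    · intro z x y hzx _ _ hf
      exact absurd (hf z hzx.1.symm) (Nat.not_lt_zero _)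
  | succ t ih =>
    obtain ⟨c, hI⟩ := ih
    by_cases h : ∃ v u, H.Adj v u ∧ rk N r v u = t
    · obtain ⟨v, u, hvu, rfl⟩ := h
      rcases lt_trichotomy (r v) (r u) with h | h | h
      · exact step_edge H hr b hN q hq hdeg hb c v u hvu h hI
      · exact absurd (hr h) hvu.ne
      · rw [rk_comm] at hI ⊢
        exact step_edge H hr b hN q hq hdeg hb c u v hvu.symm h hI
    · push Not at h
      have hf : ∀ x, fin H (rk N r) (t + 1) x ↔ fin H (rk N r) t x := by
        intro x
        refine forall_congr' fun y => forall_congr' fun hy => ?_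
        have := h x y hy
        omega
      have ha : ∀ x α, num H.Adj (rk N r) c (t + 1) x α = num H.Adj (rk N r) c t x α :=
        fun x α => num_congr_time _ _ _ _ _ _ (fun y hy => h x y hy)
      have hp : ∀ x α, num (Par H r b) (rk N r) c (t + 1) x α = num (Par H r b) (rk N r) c t x α :=
        fun x α => num_congr_time _ _ _ _ _ _ (fun y hy => h x y hy.1)
      refine ⟨c, ?_, ?_, ?_, ?_⟩
      · simpa only [ha] using hI.maj
      · simpa only [hp] using hI.load
      · simpa only [hp, hf] using hI.bal
      · simpa only [ha, hf] using hI.pal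

lemma greedy {V : Type*} [Fintype V] (H : SimpleGraph V) [DecidableRel H.Adj] {r : V → ℕ}
    (hr : Function.Injective r) (b : V) (q : ℕ) (hq : 2 ≤ q)
    (hdeg : ∀ x, H.degree x ≤ q * q) (hb : ∀ u, u ≠ b → ∃ w, H.Adj u w ∧ r u < r w) :
    ∃ c : Sym2 V → Fin (q + 3),
      (∀ x α, 2 ≤ H.degree x →
        2 * ((H.neighborFinset x).filter (fun y => c s(x, y) = α)).card ≤ H.degree x) ∧
      ∀ z x y, Par H r b z x → Par H r b z y → c s(z, x) = c s(z, y) →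
        (∀ α, ((H.neighborFinset x).filter (fun w => c s(x, w) = α)).card =
          ((H.neighborFinset y).filter (fun w => c s(y, w) = α)).card) → x = y := by
  obtain ⟨N, hN⟩ : ∃ N, ∀ x, r x < N :=
    ⟨Finset.univ.sup r + 1, fun x => Nat.lt_succ_of_le (Finset.le_sup (Finset.mem_univ x))⟩
  obtain ⟨c, hI⟩ := exists_inv H hr b hN q hq hdeg hb (N * N + N)
  have hall : ∀ x y, rk N r x y < N * N + N := by
    intro x y
    unfold rk
    have h1 : max (r x) (r y) * N ≤ N * N := Nat.mul_le_mul_right _ (max_le (hN x).le (hN y).le)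
    have h2 : min (r x) (r y) < N := lt_of_le_of_lt (min_le_left _ _) (hN x)
    omega
  have hnum : ∀ x α, num H.Adj (rk N r) c (N * N + N) x α =
      ((H.neighborFinset x).filter (fun y => c s(x, y) = α)).card := by
    intro x α
    unfold num
    congr 1
    ext y
    simp [hall]
  refine ⟨c, ?_, ?_⟩
  · intro x α hx
    rw [← hnum]
    exact hI.maj x α hx
  · intro z x y hzx hzy hc hαs
    by_contra hxy
    obtain ⟨α, hα⟩ := hI.pal z x y hzx hzy hxy (fun w _ => hall x w) (fun w _ => hall y w) hc
    rw [hnum, hnum] at hα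
    exact hα (hαs α)

end AMC

/-- Let `a`, `b` be two vertices of a connected graph `H` of maximum degree at most `Δ` such
that `dist(a,v) + dist(v,b) = dist(a,b)` for every vertex `v`. Then `H` admits an almost
majority edge coloring with `⌈√Δ⌉ + 3` colors breaking every automorphism of `H` that fixes
both `a` and `b`. -/
theorem almost_majority_coloring_breaking_stabilizer {V : Type*} [Fintype V] [DecidableEq V]
    (H : SimpleGraph V) [DecidableRel H.Adj] (Δ : ℕ)
    (hconn : H.Connected) (hΔ : ∀ v : V, H.degree v ≤ Δ) (a b : V)
    (hdist : ∀ v : V, H.dist a v + H.dist v b = H.dist a b) :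
    ∃ c : Sym2 V → Fin (⌈Real.sqrt (Δ : ℝ)⌉₊ + 3),
      IsAlmostMajorityEdgeColoring H c ∧
      ∀ φ : H ≃g H, φ a = a → φ b = b →
        (∀ u v : V, H.Adj u v → c s(φ u, φ v) = c s(u, v)) → ∀ x : V, φ x = x := by
  classical
  rcases le_or_gt Δ 1 with hΔ1 | hΔ2
  · refine ⟨fun _ => ⟨0, by omega⟩, ?_, ?_⟩
    · intro u α hu
      have := hΔ u
      omega
    · intro φ ha hb _ x
      have hstep : ∀ v u, H.Adj v u → φ v = v → φ u = u := by
        intro v u hvu hv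
        have h1 : H.Adj v (φ u) := by
          have := φ.map_adj_iff.2 hvu
          rwa [hv] at this
        have h2 : (H.neighborFinset v).card ≤ 1 := by
          rw [SimpleGraph.card_neighborFinset_eq_degree]; exact (hΔ v).trans hΔ1
        rw [Finset.card_le_one] at h2
        exact h2 _ (by simpa using h1) _ (by simpa using hvu)
      obtain ⟨w⟩ := hconn.preconnected a x
      clear hdist hb b
      induction w with
      | nil => exact ha
      | cons h p ih => exact ih (hstep _ _ h ha)
  · set q := ⌈Real.sqrt (Δ : ℝ)⌉₊ with hqdef
    have hle : Real.sqrt (Δ : ℝ) ≤ q := Nat.le_ceil _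
    have hqq : Δ ≤ q * q := by
      have h1 : (Δ : ℝ) ≤ q * q := by
        calc (Δ : ℝ) = Real.sqrt Δ * Real.sqrt Δ := (Real.mul_self_sqrt (Nat.cast_nonneg _)).symm
          _ ≤ q * q := mul_self_le_mul_self (Real.sqrt_nonneg _) hle
      exact_mod_cast h1
    have hq2 : 2 ≤ q := by
      by_contra! h
      have : q * q ≤ 1 * 1 := Nat.mul_le_mul (by omega) (by omega)
      omega
    -- the order
    let e := Fintype.equivFin V
    let r : V → ℕ := fun v => H.dist a v * Fintype.card V + (e v : ℕ)
    have hrlt : ∀ x y, H.dist a x < H.dist a y → r x < r y := fun x y h =>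
      AMC.lex_lt h (e x).2
    have hr : Function.Injective r := by
      intro x y h
      have hd : H.dist a x = H.dist a y := by
        rcases lt_trichotomy (H.dist a x) (H.dist a y) with h' | h' | h'
        · have := hrlt _ _ h'; omega
        · exact h'
        · have := hrlt _ _ h'; omega
      have h2 : H.dist a x * Fintype.card V + (e x : ℕ) =
        H.dist a y * Fintype.card V + (e y : ℕ) := h
      rw [hd] at h2
      exact e.injective (Fin.ext (by omega))
    -- a neighbour closer to a given vertex
    have hcloser : ∀ c x : V, x ≠ c → ∃ w, H.Adj x w ∧ H.dist w c + 1 = H.dist x c := by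
      intro c x hx
      obtain ⟨p, hp⟩ := hconn.exists_walk_length_eq_dist x c
      cases p with
      | nil => exact absurd rfl hx
      | @cons _ w _ h p =>
        refine ⟨w, h, ?_⟩
        rw [SimpleGraph.Walk.length_cons] at hp
        have h1 := SimpleGraph.dist_le p
        have h2 := hconn.dist_triangle (u := x) (v := w) (w := c)
        have h3 : H.dist x w = 1 := SimpleGraph.dist_eq_one_iff_adj.2 h
        omega
    have hup : ∀ u, u ≠ b → ∃ w, H.Adj u w ∧ r u < r w := by
      intro u hu
      obtain ⟨w, hw, hd⟩ := hcloser b u hu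
      refine ⟨w, hw, hrlt _ _ ?_⟩
      have := hdist u
      have := hdist w
      omega
    have hdown : ∀ u, u ≠ a → ∃ w, H.Adj u w ∧ H.dist a w < H.dist a u := by
      intro u hu
      obtain ⟨w, hw, hd⟩ := hcloser a u hu
      refine ⟨w, hw, ?_⟩
      rw [SimpleGraph.dist_comm (u := a), SimpleGraph.dist_comm (u := a)]
      omega
    have hpar : ∀ u, u ≠ a → ∃ z, H.Adj u z ∧ H.dist a z < H.dist a u ∧
        ∀ w, H.Adj u w → r z ≤ r w := by
      intro u hu
      obtain ⟨w, hw, hd⟩ := hdown u hu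
      obtain ⟨z, hz, hmin⟩ := Finset.exists_min_image (H.neighborFinset u) r ⟨w, by simpa using hw⟩
      simp only [SimpleGraph.mem_neighborFinset] at hz hmin
      refine ⟨z, hz, ?_, hmin⟩
      by_contra! h
      have h1 := hmin w hw
      have h2 := hrlt w z (by omega)
      omega
    obtain ⟨c, hmaj, hpal⟩ := AMC.greedy H hr b q hq2 (fun x => (hΔ x).trans hqq) hup
    refine ⟨c, hmaj, ?_⟩
    intro φ ha hb hc
    have hφd : ∀ x, H.dist a (φ x) = H.dist a x := by
      have hone : ∀ ψ : H ≃g H, ψ a = a → ∀ x, H.dist a (ψ x) ≤ H.dist a x := by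
        intro ψ hψ x
        obtain ⟨p, hp⟩ := hconn.exists_walk_length_eq_dist a x
        have := SimpleGraph.dist_le (p.map ψ.toHom)
        rw [SimpleGraph.Walk.length_map, hp] at this
        have h2 : H.dist (ψ a) (ψ x) ≤ H.dist a x := this
        rwa [hψ] at h2
      intro x
      refine le_antisymm (hone φ ha x) ?_
      have := hone φ.symm (by rw [RelIso.symm_apply_eq]; exact ha.symm) (φ x)
      simpa using this
    have hcnt : ∀ x α, ((H.neighborFinset (φ x)).filter (fun w => c s(φ x, w) = α)).card =
        ((H.neighborFinset x).filter (fun w => c s(x, w) = α)).card := by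
      intro x α
      symm
      apply Finset.card_bij (fun w _ => φ w)
      · intro w hw
        simp only [Finset.mem_filter, SimpleGraph.mem_neighborFinset] at hw ⊢
        exact ⟨φ.map_adj_iff.2 hw.1, by rw [hc _ _ hw.1]; exact hw.2⟩
      · intro w _ w' _ h
        exact φ.injective h
      · intro w hw
        simp only [Finset.mem_filter, SimpleGraph.mem_neighborFinset] at hw
        obtain ⟨w, rfl⟩ := φ.surjective w
        have hadj := φ.map_adj_iff.1 hw.1
        refine ⟨w, ?_, rfl⟩
        simp only [Finset.mem_filter, SimpleGraph.mem_neighborFinset]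
        exact ⟨hadj, by rw [← hc _ _ hadj]; exact hw.2⟩
    have hmain : ∀ n x, H.dist a x = n → φ x = x := by
      intro n
      induction n using Nat.strong_induction_on with
      | _ n ih =>
        intro x hx
        by_cases hxa : x = a
        · rw [hxa, ha]
        by_cases hxb : x = b
        · rw [hxb, hb]
        have hxa' : φ x ≠ a := fun h => hxa (φ.injective (h.trans ha.symm))
        have hxb' : φ x ≠ b := fun h => hxb (φ.injective (h.trans hb.symm))
        obtain ⟨z, hz, hzd, hzm⟩ := hpar x hxa
        obtain ⟨z', hz', hzd', hzm'⟩ := hpar (φ x) hxa'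
        have hφz : φ z = z := ih _ (by omega) z rfl
        have hφz' : φ z' = z' := ih _ (by rw [hφd] at hzd'; omega) z' rfl
        have h1 : H.Adj (φ x) z := by
          have := φ.map_adj_iff.2 hz
          rwa [hφz] at this
        have h2 : H.Adj x z' := by
          rw [← hφz'] at hz'
          exact φ.map_adj_iff.1 hz'
        have hzz : z = z' := hr (le_antisymm (hzm _ h2) (hzm' _ h1))
        subst hzz
        apply hpal z (φ x) x ⟨hz'.symm, hrlt _ _ hzd', hxb', hzm'⟩
          ⟨hz.symm, hrlt _ _ hzd, hxb, hzm⟩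
        · have := hc z x hz.symm
          rwa [hφz] at this
        · exact hcnt x
    exact fun x => hmain _ x rfl
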